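/- Let n ≥ 1 and let γ denote the standard Gaussian measure on ℝⁿ. For every probability measure ν on ℝⁿ with finite second moment (∫‖x‖² dν(x) < ∞), the infimum over all couplings π of γ and ν of ∫‖x − y‖² dπ(x,y) is at most 2 D(ν‖γ), where D denotes relative entropy (Talagrand's quadratic transport-entropy inequality). -/

import Mathlib

open MeasureTheory ENNReal

/-- The standard Gaussian measure on `ℝⁿ`, with density
`(2π)^{-n/2} exp(-‖x‖²/2)` w.r.t. Lebesgue measure. -/
noncomputable def stdGaussian (n : ℕ) : Measure (EuclideanSpace ℝ (Fin n)) :=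
  (volume : Measure (EuclideanSpace ℝ (Fin n))).withDensity
    (fun x => ENNReal.ofReal ((2 * Real.pi) ^ (-(n : ℝ) / 2) * Real.exp (-‖x‖ ^ 2 / 2)))

/-- The relative entropy (Kullback–Leibler divergence) `D(μ‖γ)`. -/
noncomputable def relEntropy {E : Type*} [MeasurableSpace E] (μ γ : Measure E) : ℝ≥0∞ :=
  open scoped Classical in
  if μ ≪ γ ∧ Integrable (llr μ γ) μ then ENNReal.ofReal (∫ x, llr μ γ x ∂μ) else ∞

/-- `π` is a coupling of `μ` and `ν` if its marginals are `μ` and `ν`. -/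
def IsCoupling {E : Type*} [MeasurableSpace E] (π : Measure (E × E)) (μ ν : Measure E) : Prop :=
  π.map Prod.fst = μ ∧ π.map Prod.snd = ν

section

open ProbabilityTheory InformationTheory Set Filter Topology
open scoped NNReal

lemma continuous_cdf (ν : Measure ℝ) [IsProbabilityMeasure ν] [NullSingletonClass ν] :
    Continuous (cdf ν) := by
  refine continuous_iff_continuousAt.2 fun x => ?_
  have h := (cdf ν).measure_singleton x
  rw [measure_cdf, measure_singleton, eq_comm, ENNReal.ofReal_eq_zero] at h
  rw [(cdf ν).mono.continuousAt_iff_leftLim_eq_rightLim, (cdf ν).rightLim_eq]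
  exact le_antisymm ((cdf ν).mono.leftLim_le le_rfl) (by linarith)

lemma exists_cdf_preimage_Iic (ν : Measure ℝ) [IsProbabilityMeasure ν] [NullSingletonClass ν]
    {u : ℝ} (h0 : 0 < u) (h1 : u < 1) : ∃ y, cdf ν y = u ∧ {z | cdf ν z ≤ u} = Iic y := by
  have hc := continuous_cdf ν
  have hne : {z | cdf ν z ≤ u}.Nonempty :=
    (((tendsto_cdf_atBot ν).eventually (gt_mem_nhds h0)).exists).imp fun _ h => le_of_lt h
  have hbdd : BddAbove {z | cdf ν z ≤ u} := by
    obtain ⟨b, hb⟩ := ((tendsto_cdf_atTop ν).eventually (lt_mem_nhds h1)).exists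
    refine ⟨b, fun z hz => le_of_not_gt fun hbz => ?_⟩
    exact absurd (hb.trans_le (monotone_cdf ν hbz.le)) (not_lt.2 hz)
  have hcl : IsClosed {z | cdf ν z ≤ u} := isClosed_le hc continuous_const
  have hmem := hcl.csSup_mem hne hbdd
  refine ⟨sSup {z | cdf ν z ≤ u}, le_antisymm hmem ?_, ?_⟩
  · refine ge_of_tendsto (hc.continuousWithinAt (s := Ioi (sSup {z | cdf ν z ≤ u}))) ?_
    filter_upwards [self_mem_nhdsWithin] with z hz
    exact le_of_not_ge fun h => absurd (le_csSup hbdd h) (not_le.2 hz)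
  · ext z
    exact ⟨fun h => le_csSup hbdd h, fun h => (monotone_cdf ν h).trans hmem⟩

/-- The quantile function of the standard Gaussian, extended by `0` outside `(0, 1)`. -/
noncomputable def gaussQuantile (u : ℝ) : ℝ :=
  open scoped Classical in
  if 0 < u ∧ u < 1 then Function.invFun (cdf (gaussianReal 0 1)) u else 0

instance : NullSingletonClass (gaussianReal 0 1) := nullSingletonClass_gaussianReal one_ne_zero

lemma cdf_gaussQuantile {u : ℝ} (h0 : 0 < u) (h1 : u < 1) :
    cdf (gaussianReal 0 1) (gaussQuantile u) = u := by
  rw [gaussQuantile, if_pos ⟨h0, h1⟩]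
  exact Function.invFun_eq
    ((exists_cdf_preimage_Iic (gaussianReal 0 1) h0 h1).imp fun _ h => h.1)

lemma strictMono_cdf_gaussianReal : StrictMono (cdf (gaussianReal 0 1)) := by
  intro a b hab
  have h1 := (cdf (gaussianReal 0 1)).measure_Ioc a b
  rw [measure_cdf] at h1
  have h2 : gaussianReal 0 1 (Ioc a b) ≠ 0 := fun h => by
    have := gaussianReal_absolutelyContinuous' 0 one_ne_zero h
    simp at this
    linarith
  rw [h1] at h2
  have := ENNReal.ofReal_pos.1 (pos_iff_ne_zero.2 h2)
  linarith

lemma cdf_gaussianReal_mem_Ioo (t : ℝ) :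
    0 < cdf (gaussianReal 0 1) t ∧ cdf (gaussianReal 0 1) t < 1 :=
  ⟨(cdf_nonneg _ (t - 1)).trans_lt (strictMono_cdf_gaussianReal (by linarith)),
    (strictMono_cdf_gaussianReal (lt_add_one t)).trans_le (cdf_le_one _ _)⟩

lemma gaussQuantile_le_iff {u t : ℝ} (h0 : 0 < u) (h1 : u < 1) :
    gaussQuantile u ≤ t ↔ u ≤ cdf (gaussianReal 0 1) t := by
  rw [← strictMono_cdf_gaussianReal.le_iff_le, cdf_gaussQuantile h0 h1]

@[fun_prop]
lemma measurable_gaussQuantile : Measurable gaussQuantile := by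
  refine measurable_of_Iic fun t => ?_
  have : gaussQuantile ⁻¹' Iic t = (Ioo 0 1 ∩ Iic (cdf (gaussianReal 0 1) t)) ∪
      ((Ioo 0 1)ᶜ ∩ {_u | (0 : ℝ) ≤ t}) := by
    ext u
    by_cases hu : 0 < u ∧ u < 1
    · simp [gaussQuantile_le_iff hu.1 hu.2, hu]
    · simp only [mem_preimage, mem_Iic, gaussQuantile, if_neg hu]
      simp [hu]
  rw [this]
  measurability

lemma cdf_mem_Ioo_ae (ν : Measure ℝ) [IsProbabilityMeasure ν] [NullSingletonClass ν] :
    ∀ᵐ y ∂ν, 0 < cdf ν y ∧ cdf ν y < 1 := by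
  have key : ∀ u, 0 < u → u < 1 → ν {z | cdf ν z ≤ u} = ENNReal.ofReal u := fun u h0 h1 => by
    obtain ⟨y, hy, hs⟩ := exists_cdf_preimage_Iic ν h0 h1
    rw [hs, ← ofReal_cdf, hy]
  have hsmall : ∀ s : Set ℝ, (∀ ε : ℝ, 0 < ε → ε < 1 → ν s ≤ ENNReal.ofReal ε) → ν s = 0 := by
    intro s hs
    refine nonpos_iff_eq_zero.1 (ENNReal.le_of_forall_pos_le_add fun ε hε _ => ?_)
    rw [zero_add]
    refine (hs (min ε 2⁻¹) (by positivity) ((min_le_right _ _).trans_lt (by norm_num))).trans ?_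
    rw [← ENNReal.ofReal_coe_nnreal]
    exact ENNReal.ofReal_le_ofReal (min_le_left _ _)
  refine Filter.Eventually.and ?_ ?_
  · refine hsmall _ fun ε h0 h1 => (measure_mono fun z hz => ?_).trans (key ε h0 h1).le
    exact (not_lt.1 (show ¬ 0 < cdf ν z from hz)).trans h0.le
  · refine hsmall _ fun ε h0 h1 => ?_
    have hle : ν {z | ¬cdf ν z < 1} ≤ ν {z | cdf ν z ≤ 1 - ε}ᶜ :=
      measure_mono fun z hz hz' => hz (hz'.trans_lt (by linarith))
    refine hle.trans ?_
    have hm : MeasurableSet {z | cdf ν z ≤ 1 - ε} :=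
      (monotone_cdf ν).measurable measurableSet_Iic
    rw [prob_compl_eq_one_sub hm,
      key _ (by linarith) (by linarith), ← ENNReal.ofReal_one,
      ← ENNReal.ofReal_sub _ (by linarith)]
    simp

lemma map_gaussQuantile_cdf (ν : Measure ℝ) [IsProbabilityMeasure ν] [NullSingletonClass ν] :
    ν.map (fun y => gaussQuantile (cdf ν y)) = gaussianReal 0 1 := by
  have hm : Measurable fun y => gaussQuantile (cdf ν y) :=
    measurable_gaussQuantile.comp (monotone_cdf ν).measurable
  have := Measure.isProbabilityMeasure_map (μ := ν) hm.aemeasurable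
  refine Measure.ext_of_Iic _ _ fun t => ?_
  rw [Measure.map_apply hm measurableSet_Iic]
  obtain ⟨y, hy, hs⟩ := exists_cdf_preimage_Iic ν (cdf_gaussianReal_mem_Ioo t).1
    (cdf_gaussianReal_mem_Ioo t).2
  rw [← ofReal_cdf (gaussianReal 0 1) t, ← hy, ofReal_cdf, ← hs]
  refine measure_congr ?_
  filter_upwards [cdf_mem_Ioo_ae ν] with z hz
  exact propext (gaussQuantile_le_iff hz.1 hz.2)

lemma setIntegral_Ioi_id_gaussianReal (s : ℝ) :
    ∫ x in Ioi s, x ∂(gaussianReal 0 1) = gaussianPDFReal 0 1 s := by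
  have hφ : ∀ x, HasDerivAt (fun x => -gaussianPDFReal 0 1 x) (gaussianPDFReal 0 1 x * x) x := by
    intro x
    have h1 : HasDerivAt (fun x : ℝ => -(x - 0) ^ 2 / (2 * (1 : ℝ≥0))) (-x) x := by
      have := ((((hasDerivAt_id x).sub_const 0).pow 2).neg).div_const (2 * ((1 : ℝ≥0) : ℝ))
      refine this.congr_deriv ?_
      simp
      ring
    have := (h1.exp.const_mul (√(2 * Real.pi * (1 : ℝ≥0)))⁻¹).neg
    refine this.congr_deriv ?_
    simp only [gaussianPDFReal]
    ring
  have hint : Integrable fun x : ℝ => gaussianPDFReal 0 1 x * x := by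
    have h := (memLp_id_gaussianReal (μ := 0) (v := 1) 1).integrable le_rfl
    rw [gaussianReal_of_var_ne_zero _ one_ne_zero,
      integrable_withDensity_iff_integrable_smul' (by fun_prop)
        (ae_of_all _ fun _ => gaussianPDF_lt_top)] at h
    simpa using h
  have hlim : Tendsto (fun x => -gaussianPDFReal 0 1 x) atTop (𝓝 0) :=
    tendsto_zero_of_hasDerivAt_of_integrableOn_Ioi (a := s) (fun x _ => hφ x)
      hint.integrableOn (integrable_gaussianPDFReal 0 1).neg.integrableOn
  have h := integral_Ioi_of_hasDerivAt_of_tendsto' (a := s) (fun x _ => hφ x)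
    hint.integrableOn hlim
  rw [zero_sub, neg_neg, ← integral_indicator measurableSet_Ioi] at h
  rw [← integral_indicator measurableSet_Ioi, integral_gaussianReal_eq_integral_smul one_ne_zero,
    ← h]
  congr 1
  ext x
  simp [indicator]

lemma integrable_integral_Ioi {ν : Measure ℝ} [IsProbabilityMeasure ν] {g : ℝ → ℝ}
    (hg : Integrable g ν) (hg0 : ∫ y, g y ∂ν = 0) (hyg : Integrable (fun y => g y * y) ν) :
    Integrable (fun t => ∫ y in Ioi t, g y ∂ν) ∧
      ∫ t, ∫ y in Ioi t, g y ∂ν = ∫ y, g y * y ∂ν := by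
  let k : ℝ → ℝ → ℝ := fun y t =>
    (Ioi t).indicator 1 y - (Iic (0 : ℝ)).indicator 1 t
  have hk1 : ∀ y, k y = fun t => (Ioo 0 y).indicator 1 t - (Icc y 0).indicator 1 t := by
    intro y
    ext t
    simp only [k, indicator, mem_Ioi, mem_Iic, mem_Ioo, mem_Icc, Pi.one_apply]
    grind
  have hk2 : ∀ y, (fun t => ‖k y t‖) =
      fun t => (Ioo 0 y).indicator 1 t + (Icc y 0).indicator 1 t := by
    intro y
    ext t
    simp only [k, indicator, mem_Ioi, mem_Iic, mem_Ioo, mem_Icc, Pi.one_apply, Real.norm_eq_abs]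
    grind
  have hi1 : ∀ y : ℝ, Integrable ((Ioo 0 y).indicator (1 : ℝ → ℝ)) := fun y =>
    (integrable_indicator_iff measurableSet_Ioo).2 (integrableOn_const (by simp))
  have hi2 : ∀ y : ℝ, Integrable ((Icc y 0).indicator (1 : ℝ → ℝ)) := fun y =>
    (integrable_indicator_iff measurableSet_Icc).2 (integrableOn_const (by simp))
  have hkint : ∀ y, ∫ t, k y t = y := by
    intro y
    rw [hk1, integral_sub (hi1 y) (hi2 y), integral_indicator_one measurableSet_Ioo,
      integral_indicator_one measurableSet_Icc]
    simp
  have hkabs : ∀ y, ∫ t, ‖k y t‖ = |y| := by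
    intro y
    rw [hk2, integral_add (hi1 y) (hi2 y), integral_indicator_one measurableSet_Ioo,
      integral_indicator_one measurableSet_Icc]
    simp
  have hkm : Measurable (Function.uncurry k) := by
    have h1 : Measurable fun p : ℝ × ℝ => ({q : ℝ × ℝ | q.2 < q.1}.indicator 1 p : ℝ) :=
      measurable_one.indicator (measurableSet_lt measurable_snd measurable_fst)
    have h2 : Measurable fun p : ℝ × ℝ => ((Iic (0 : ℝ)).indicator 1 p.2 : ℝ) :=
      (measurable_one.indicator measurableSet_Iic).comp measurable_snd
    exact h1.sub h2
  have hK : Integrable (Function.uncurry fun y t => g y * k y t) (ν.prod volume) := by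
    refine (integrable_prod_iff ?_).2 ⟨?_, ?_⟩
    · exact hg.aestronglyMeasurable.comp_fst.mul hkm.aestronglyMeasurable
    · refine Eventually.of_forall fun y => ?_
      simp only [Function.uncurry_apply_pair]
      rw [hk1]
      exact ((hi1 y).sub (hi2 y)).const_mul _
    · simp only [Function.uncurry_apply_pair, norm_mul, integral_const_mul, hkabs]
      simpa using hyg.norm
  have hH : (fun t => ∫ y in Ioi t, g y ∂ν) = fun t => ∫ y, g y * k y t ∂ν := by
    ext t
    have h1 : Integrable (fun y => (Ioi t).indicator g y) ν := hg.indicator measurableSet_Ioi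
    rw [← integral_indicator measurableSet_Ioi]
    have : ∀ y, g y * k y t = (Ioi t).indicator g y - g y * (Iic (0 : ℝ)).indicator 1 t := by
      intro y
      simp only [k, indicator, Pi.one_apply]
      grind
    simp_rw [this]
    rw [integral_sub h1 (hg.mul_const _), integral_mul_const, hg0]
    simp
  rw [hH]
  refine ⟨hK.integral_prod_right, ?_⟩
  rw [← integral_integral_swap hK]
  simp_rw [integral_const_mul, hkint]

lemma integral_Ioi_gaussQuantile_cdf (ν : Measure ℝ) [IsProbabilityMeasure ν]
    [NullSingletonClass ν] {t : ℝ} (h0 : 0 < cdf ν t) (h1 : cdf ν t < 1) :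
    ∫ y in Ioi t, gaussQuantile (cdf ν y) ∂ν = gaussianPDFReal 0 1 (gaussQuantile (cdf ν t)) := by
  have hm : Measurable fun y => gaussQuantile (cdf ν y) :=
    measurable_gaussQuantile.comp (monotone_cdf ν).measurable
  have hmap := map_gaussQuantile_cdf ν
  obtain ⟨z, hz, hs⟩ := exists_cdf_preimage_Iic ν h0 h1
  have hIoi : (Ioi t : Set ℝ) =ᵐ[ν] Ioi z := by
    have htz : t ≤ z := by
      have : t ∈ {x | cdf ν x ≤ cdf ν t} := le_refl (cdf ν t)
      rwa [hs] at this
    have : ν (Ioc t z) = 0 := by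
      rw [← measure_cdf ν, StieltjesFunction.measure_Ioc, hz]
      simp
    symm
    refine ae_eq_set.2 ⟨?_, ?_⟩
    · rw [sdiff_eq_empty.2 (Ioi_subset_Ioi htz), measure_empty]
    · rwa [Ioi_sdiff_Ioi]
  have hpre : (Ioi z : Set ℝ) =ᵐ[ν]
      (fun y => gaussQuantile (cdf ν y)) ⁻¹' Ioi (gaussQuantile (cdf ν t)) := by
    filter_upwards [cdf_mem_Ioo_ae ν] with y hy
    have : y ∈ {x | cdf ν x ≤ cdf ν t} ↔ y ∈ Iic z := by rw [hs]
    have h2 := gaussQuantile_le_iff (t := gaussQuantile (cdf ν t)) hy.1 hy.2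
    rw [cdf_gaussQuantile h0 h1] at h2
    refine propext ?_
    change z < y ↔ gaussQuantile (cdf ν t) < gaussQuantile (cdf ν y)
    simp only [mem_ofPred_eq, mem_Iic] at this
    rw [← not_le, ← not_le, h2, this]
  rw [setIntegral_congr_set (hIoi.trans hpre), ← setIntegral_Ioi_id_gaussianReal, ← hmap,
    setIntegral_map measurableSet_Ioi (by fun_prop) hm.aemeasurable]

lemma integral_Ioi_gaussQuantile_cdf_nonneg (ν : Measure ℝ) [IsProbabilityMeasure ν]
    [NullSingletonClass ν] (t : ℝ) : 0 ≤ ∫ y in Ioi t, gaussQuantile (cdf ν y) ∂ν := by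
  rcases (cdf_nonneg ν t).eq_or_lt with h0 | h0
  · have hm : Measurable fun y => gaussQuantile (cdf ν y) :=
      measurable_gaussQuantile.comp (monotone_cdf ν).measurable
    have hIic : ν (Iic t) = 0 := by rw [← ofReal_cdf, ← h0, ENNReal.ofReal_zero]
    have huniv : (Ioi t : Set ℝ) =ᵐ[ν] univ := by
      rw [ae_eq_univ, compl_Ioi, hIic]
    have hid : ∫ x, x ∂(gaussianReal 0 1) = 0 := integral_id_gaussianReal
    rw [← map_gaussQuantile_cdf ν, integral_map hm.aemeasurable (by fun_prop)] at hid
    rw [setIntegral_congr_set huniv, setIntegral_univ, hid]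
  rcases (cdf_le_one ν t).eq_or_lt with h1 | h1
  · have hIoi : ν (Ioi t) = 0 := by
      rw [← compl_Iic, prob_compl_eq_zero_iff measurableSet_Iic, ← ofReal_cdf, h1,
        ENNReal.ofReal_one]
    rw [Measure.restrict_eq_zero.2 hIoi, integral_zero_measure]
  · rw [integral_Ioi_gaussQuantile_cdf ν h0 h1]
    exact gaussianPDFReal_nonneg _ _ _

/-- The transport-entropy inequality on the line, realised by the monotone rearrangement. -/
theorem lintegral_gaussQuantile_cdf_le {ν : Measure ℝ} [IsProbabilityMeasure ν]
    (hν : MemLp id 2 ν) :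
    ∫⁻ y, ENNReal.ofReal ((gaussQuantile (cdf ν y) - y) ^ 2) ∂ν ≤
      2 * klDiv ν (gaussianReal 0 1) := by
  set γ := gaussianReal 0 1 with hγ
  by_cases hfin : klDiv ν γ = ∞
  · simp [hfin]
  obtain ⟨hac, hllr⟩ := klDiv_ne_top_iff.1 hfin
  have : NullSingletonClass ν := ⟨fun x => hac (measure_singleton x)⟩
  set S : ℝ → ℝ := fun y => gaussQuantile (cdf ν y) with hS
  have hm : Measurable S := measurable_gaussQuantile.comp (monotone_cdf ν).measurable
  have hmap : ν.map S = γ := map_gaussQuantile_cdf ν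
  have hL2 : MemLp S 2 ν := by
    have : MemLp id 2 (ν.map S) := hmap ▸ memLp_id_gaussianReal 2
    exact this.comp_of_map hm.aemeasurable
  have hS2 : ∫ y, S y ^ 2 ∂ν = 1 := by
    have : ∫ x, x ^ 2 ∂γ = 1 := by
      have h := variance_id_gaussianReal (μ := 0) (v := 1)
      rw [variance_eq_integral (by fun_prop)] at h
      simpa using h
    rw [← this, ← hmap, integral_map hm.aemeasurable (by fun_prop)]
  have hS0 : ∫ y, S y ∂ν = 0 := by
    have : ∫ x, x ∂γ = 0 := integral_id_gaussianReal
    rw [← this, ← hmap, integral_map hm.aemeasurable (by fun_prop)]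
  have hSy : Integrable (fun y => S y * y) ν := hL2.integrable_mul hν
  obtain ⟨hHint, hHeq⟩ := integrable_integral_Ioi (hL2.integrable (by norm_num)) hS0 hSy
  set H : ℝ → ℝ := fun t => ∫ y in Ioi t, S y ∂ν with hH
  have hH0 : ∀ t, 0 ≤ H t := integral_Ioi_gaussQuantile_cdf_nonneg ν
  set f : ℝ → ℝ := fun y => (ν.rnDeriv γ y).toReal with hf
  have hfm : Measurable f := (Measure.measurable_rnDeriv ν γ).ennreal_toReal
  set J : ℝ → ℝ := fun y => (f y)⁻¹ * Real.exp ((y ^ 2 - S y ^ 2) / 2) with hJ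
  have hJm : Measurable J := by fun_prop
  have hJ0 : ∀ y, 0 ≤ J y := fun y => by positivity
  set A : Set ℝ := {y | 0 < cdf ν y ∧ cdf ν y < 1} with hA
  have hAm : MeasurableSet A :=
    (monotone_cdf ν).measurable measurableSet_Ioo
  have hJle : ∫⁻ y, ENNReal.ofReal (J y) ∂ν ≤ ENNReal.ofReal (∫ y, S y * y ∂ν) := by
    calc ∫⁻ y, ENNReal.ofReal (J y) ∂ν
        = ∫⁻ y, A.indicator (fun y => ENNReal.ofReal (J y)) y ∂ν := by
          refine lintegral_congr_ae ?_
          filter_upwards [cdf_mem_Ioo_ae ν] with y hy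
          rw [indicator_of_mem (show y ∈ A from hy)]
      _ = ∫⁻ y, ν.rnDeriv γ y * A.indicator (fun y => ENNReal.ofReal (J y)) y ∂γ := by
          rw [lintegral_rnDeriv_mul hac (by fun_prop)]
      _ ≤ ∫⁻ y, A.indicator (fun y => ENNReal.ofReal (Real.exp ((y ^ 2 - S y ^ 2) / 2))) y ∂γ := by
          refine lintegral_mono_ae ?_
          filter_upwards [ν.rnDeriv_lt_top γ] with y hy
          by_cases hyA : y ∈ A
          · rw [indicator_of_mem hyA, indicator_of_mem hyA, ← ENNReal.ofReal_toReal hy.ne,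
              ← ENNReal.ofReal_mul (by positivity)]
            refine ENNReal.ofReal_le_ofReal ?_
            change f y * ((f y)⁻¹ * _) ≤ _
            rw [← mul_assoc]
            exact mul_le_of_le_one_left (by positivity) mul_inv_le_one
          · simp [hyA]
      _ = ∫⁻ y, gaussianPDF 0 1 y *
            A.indicator (fun y => ENNReal.ofReal (Real.exp ((y ^ 2 - S y ^ 2) / 2))) y := by
          rw [hγ, gaussianReal_of_var_ne_zero _ one_ne_zero,
            lintegral_withDensity_eq_lintegral_mul _ (by fun_prop) (by fun_prop)]
          rfl
      _ ≤ ∫⁻ y, ENNReal.ofReal (H y) := by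
          refine lintegral_mono fun y => ?_
          by_cases hyA : y ∈ A
          · rw [indicator_of_mem hyA, gaussianPDF, ← ENNReal.ofReal_mul
              (gaussianPDFReal_nonneg _ _ _)]
            refine ENNReal.ofReal_le_ofReal (le_of_eq ?_)
            rw [hH]
            simp only
            rw [integral_Ioi_gaussQuantile_cdf ν hyA.1 hyA.2]
            simp only [gaussianPDFReal, mul_assoc, ← Real.exp_add]
            congr 2
            simp
            ring
          · simp [hyA]
      _ = ENNReal.ofReal (∫ y, S y * y ∂ν) := by
          rw [← hHeq, ofReal_integral_eq_lintegral_ofReal hHint (ae_of_all _ hH0)]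
  have hJint : Integrable J ν := by
    refine (lintegral_ofReal_ne_top_iff_integrable hJm.aestronglyMeasurable (ae_of_all _ hJ0)).1 ?_
    exact ne_top_of_le_ne_top ENNReal.ofReal_ne_top hJle
  have hJle' : ∫ y, J y ∂ν ≤ ∫ y, S y * y ∂ν := by
    rw [← ofReal_integral_eq_lintegral_ofReal hJint (ae_of_all _ hJ0)] at hJle
    exact (ENNReal.ofReal_le_ofReal_iff (hHeq ▸ integral_nonneg hH0)).1 hJle
  have hlog : ∀ᵐ y ∂ν, y ^ 2 / 2 - S y ^ 2 / 2 + 1 - J y ≤ llr ν γ y := by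
    filter_upwards [Measure.rnDeriv_pos hac, hac.ae_le (ν.rnDeriv_lt_top γ)] with y hy hy'
    have hfy : 0 < f y := ENNReal.toReal_pos hy.ne' hy'.ne
    have h := Real.one_sub_inv_le_log_of_pos
      (mul_pos hfy (Real.exp_pos ((S y ^ 2 - y ^ 2) / 2)))
    rw [Real.log_mul hfy.ne' (Real.exp_pos _).ne', Real.log_exp, mul_inv, ← Real.exp_neg] at h
    have e : -((S y ^ 2 - y ^ 2) / 2) = (y ^ 2 - S y ^ 2) / 2 := by ring
    rw [e] at h
    change _ ≤ Real.log (f y)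
    simp only [hJ]
    linarith
  have hy2 : Integrable (fun y => y ^ 2) ν := hν.integrable_sq
  have hS2i : Integrable (fun y => S y ^ 2) ν := hL2.integrable_sq
  have hmain := integral_mono_ae
    ((((hy2.div_const 2).sub (hS2i.div_const 2)).add (integrable_const 1)).sub hJint) hllr hlog
  have hi : ∫ y, (y ^ 2 / 2 - S y ^ 2 / 2 + 1 - J y) ∂ν =
      (∫ y, y ^ 2 ∂ν) / 2 - 1 / 2 + 1 - ∫ y, J y ∂ν := by
    rw [integral_sub (by fun_prop) hJint, integral_add (by fun_prop) (by fun_prop),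
      integral_sub (by fun_prop) (by fun_prop), integral_div, integral_div, hS2]
    simp
  have hsq : ∫ y, (S y - y) ^ 2 ∂ν = 1 - 2 * ∫ y, S y * y ∂ν + ∫ y, y ^ 2 ∂ν := by
    have : ∀ y, (S y - y) ^ 2 = S y ^ 2 - 2 * (S y * y) + y ^ 2 := fun y => by ring
    simp_rw [this]
    rw [integral_add (by fun_prop) hy2, integral_sub hS2i (by fun_prop), integral_const_mul, hS2]
  have hsqi : Integrable (fun y => (S y - y) ^ 2) ν := (hL2.sub hν).integrable_sq
  rw [klDiv_of_ac_of_integrable hac hllr, ← ofReal_integral_eq_lintegral_ofReal hsqi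
    (ae_of_all _ fun y => sq_nonneg _), ← ENNReal.ofReal_ofNat 2,
    ← ENNReal.ofReal_mul (by norm_num)]
  refine ENNReal.ofReal_le_ofReal ?_
  have hi' := hi.symm.trans_le hmain
  simp only [probReal_univ, add_sub_cancel_right]
  linarith

/-- The averaged divergence between two Markov kernels is at most the divergence between the
joint laws they generate from a common first marginal. -/
lemma lintegral_klDiv_le_klDiv_compProd {α β : Type*} {mα : MeasurableSpace α}
    {mβ : MeasurableSpace β} [MeasurableSpace.CountableOrCountablyGenerated α β]
    (μ : Measure α) [IsFiniteMeasure μ] (κ η : Kernel α β) [IsMarkovKernel κ] [IsMarkovKernel η] :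
    ∫⁻ x, klDiv (κ x) (η x) ∂μ ≤ klDiv (μ ⊗ₘ κ) (μ ⊗ₘ η) := by
  by_cases hac : μ ⊗ₘ κ ≪ μ ⊗ₘ η
  swap
  · simp [klDiv_of_not_ac hac]
  have hac' : ∀ᵐ x ∂μ, κ x ≪ η x := hac.kernel_of_compProd
  have hκ : ∀ᵐ x ∂μ, κ x = η.withDensity (κ.rnDeriv η) x := by
    filter_upwards [hac'] with x hx using (Kernel.withDensity_rnDeriv_eq hx).symm
  have hd : μ ⊗ₘ κ = (μ ⊗ₘ η).withDensity fun p => κ.rnDeriv η p.1 p.2 := by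
    rw [Measure.compProd_congr hκ, Measure.compProd_withDensity (by fun_prop)]
  have hrn : (μ ⊗ₘ κ).rnDeriv (μ ⊗ₘ η) =ᵐ[μ ⊗ₘ η] fun p => κ.rnDeriv η p.1 p.2 := by
    conv_lhs => rw [hd]
    exact Measure.rnDeriv_withDensity _ (by fun_prop)
  rw [klDiv_eq_lintegral_klFun_of_ac hac, Measure.lintegral_compProd
    (by fun_prop)]
  refine lintegral_mono_ae ?_
  filter_upwards [hac', Measure.ae_ae_of_ae_compProd hrn] with x hx hx'
  rw [klDiv_eq_lintegral_klFun_of_ac hx]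
  refine lintegral_mono_ae ?_
  filter_upwards [hx', Kernel.rnDeriv_eq_rnDeriv_measure (κ := κ) (η := η) (a := x)] with y h1 h2
  rw [h1, h2]

/-- A transport map to `γ` on the first factor extends, by rearranging each conditional law, to a
transport map to the product of `γ` with a Gaussian factor, at a cost controlled by the divergence. -/
theorem exists_map_prod_gaussianReal {E : Type*} [MeasurableSpace E] {γ : Measure E}
    [IsProbabilityMeasure γ] {ρ : Measure (E × ℝ)} [IsProbabilityMeasure ρ]
    (hρ2 : MemLp Prod.snd 2 ρ) (hρ : klDiv ρ (γ.prod (gaussianReal 0 1)) ≠ ∞)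
    {S : E → E} (hS : Measurable S) (hSmap : ρ.fst.map S = γ) :
    ∃ T : E × ℝ → ℝ, Measurable T ∧
      ρ.map (fun p => (S p.1, T p)) = γ.prod (gaussianReal 0 1) ∧
      2 * klDiv ρ.fst γ + ∫⁻ p, ENNReal.ofReal ((T p - p.2) ^ 2) ∂ρ ≤
        2 * klDiv ρ (γ.prod (gaussianReal 0 1)) := by
  set μ := ρ.fst with hμ
  set κ := ρ.condKernel with hκ
  set η : Kernel E ℝ := Kernel.const E (gaussianReal 0 1) with hη
  have hdis : μ ⊗ₘ κ = ρ := ρ.disintegrate κ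
  have hprod : γ ⊗ₘ η = γ.prod (gaussianReal 0 1) := Measure.compProd_const
  have hchain : klDiv ρ (γ.prod (gaussianReal 0 1)) = klDiv μ γ + klDiv ρ (μ ⊗ₘ η) := by
    rw [← hprod, ← hdis, klDiv_compProd_eq_add]
  have hfin : klDiv ρ (μ ⊗ₘ η) ≠ ∞ := fun h => hρ (by rw [hchain, h, add_top])
  have hac : ∀ᵐ x ∂μ, κ x ≪ gaussianReal 0 1 := by
    have := (klDiv_ne_top_iff.1 hfin).1
    rw [← hdis] at this
    exact this.kernel_of_compProd
  have hmem : ∀ᵐ x ∂μ, MemLp id 2 (κ x) := by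
    have h := hρ2.integrable_sq
    rw [← hdis, Measure.integrable_compProd_iff (by fun_prop)] at h
    filter_upwards [h.1] with x hx
    exact (memLp_two_iff_integrable_sq (by fun_prop)).2 hx
  let T : E × ℝ → ℝ := fun p => gaussQuantile (cdf (κ p.1) p.2)
  have hT : Measurable T := by
    refine measurable_gaussQuantile.comp ?_
    simp_rw [cdf_eq_real, measureReal_def]
    refine Measurable.ennreal_toReal ?_
    have hs : MeasurableSet {q : (E × ℝ) × ℝ | q.2 ≤ q.1.2} :=
      measurableSet_le (by fun_prop) (by fun_prop)
    exact Kernel.measurable_kernel_prodMk_left (κ := κ.prodMkRight ℝ) hs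
  refine ⟨T, hT, ?_, ?_⟩
  · have hmap1 : ∀ᵐ x ∂μ, (κ x).map (fun y => T (x, y)) = gaussianReal 0 1 := by
      filter_upwards [hac] with x hx
      have : NullSingletonClass (κ x) := ⟨fun y => hx (measure_singleton y)⟩
      exact map_gaussQuantile_cdf (κ x)
    have hST : Measurable fun p : E × ℝ => (S p.1, T p) := by fun_prop
    refine (Measure.prod_eq fun s t hs ht => ?_).symm
    rw [Measure.map_apply hST (hs.prod ht), ← hdis,
      Measure.compProd_apply (hST (hs.prod ht)), ← hSmap, Measure.map_apply hS hs]
    calc ∫⁻ x, κ x (Prod.mk x ⁻¹' ((fun p => (S p.1, T p)) ⁻¹' s ×ˢ t)) ∂μ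
        = ∫⁻ x, (S ⁻¹' s).indicator (fun _ => gaussianReal 0 1 t) x ∂μ := by
          refine lintegral_congr_ae ?_
          filter_upwards [hmap1] with x hx
          by_cases hxs : S x ∈ s
          · rw [indicator_of_mem (show x ∈ S ⁻¹' s from hxs), ← hx,
              Measure.map_apply (by fun_prop) ht]
            congr 1
            ext y
            simp [hxs]
          · rw [indicator_of_notMem (show x ∉ S ⁻¹' s from hxs)]
            convert measure_empty (μ := κ x)
            ext y
            simp [hxs]
      _ = μ (S ⁻¹' s) * gaussianReal 0 1 t := by
          rw [lintegral_indicator (hS hs), setLIntegral_const, mul_comm]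
  · rw [hchain, mul_add]
    gcongr
    calc ∫⁻ p, ENNReal.ofReal ((T p - p.2) ^ 2) ∂ρ
        = ∫⁻ x, ∫⁻ y, ENNReal.ofReal ((T (x, y) - y) ^ 2) ∂(κ x) ∂μ := by
          conv_lhs => rw [← hdis]
          rw [Measure.lintegral_compProd (by fun_prop)]
      _ ≤ ∫⁻ x, 2 * klDiv (κ x) (η x) ∂μ := by
          refine lintegral_mono_ae ?_
          filter_upwards [hmem] with x hx
          exact lintegral_gaussQuantile_cdf_le hx
      _ = 2 * ∫⁻ x, klDiv (κ x) (η x) ∂μ := lintegral_const_mul' _ _ (by simp)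
      _ ≤ 2 * klDiv ρ (μ ⊗ₘ η) := by
          gcongr
          conv_rhs => rw [← hdis]
          exact lintegral_klDiv_le_klDiv_compProd μ κ η

lemma map_pi_gaussianReal_tail (n : ℕ) :
    (Measure.pi fun _ : Fin (n + 1) => gaussianReal 0 1).map
        (fun y => ((fun i : Fin n => y i.succ), y 0)) =
      (Measure.pi fun _ : Fin n => gaussianReal 0 1).prod (gaussianReal 0 1) := by
  have h := (measurePreserving_piFinSuccAbove
    (fun _ : Fin (n + 1) => gaussianReal 0 1) 0).map_eq
  rw [← Measure.prod_swap, ← h, Measure.map_map measurable_swap (MeasurableEquiv.measurable _)]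
  rfl

/-- A Knothe-type map transporting `ν` to the product Gaussian measure, with quadratic cost at most
twice the divergence. -/
theorem exists_map_pi_gaussianReal {n : ℕ} {ν : Measure (Fin n → ℝ)} [IsProbabilityMeasure ν]
    (hν2 : ∀ i, MemLp (fun y => y i) 2 ν)
    (hν : klDiv ν (Measure.pi fun _ => gaussianReal 0 1) ≠ ∞) :
    ∃ S : (Fin n → ℝ) → (Fin n → ℝ), Measurable S ∧
      ν.map S = (Measure.pi fun _ => gaussianReal 0 1) ∧
      ∑ i, ∫⁻ y, ENNReal.ofReal ((S y i - y i) ^ 2) ∂ν ≤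
        2 * klDiv ν (Measure.pi fun _ => gaussianReal 0 1) := by
  induction n with
  | zero =>
    refine ⟨id, measurable_id, ?_, by simp⟩
    rw [Measure.map_id]
    ext s hs
    rcases Subsingleton.eq_empty_or_singleton s.subsingleton_of_subsingleton with h | ⟨x, h⟩
    · simp [h]
    · have : s = univ := by rw [h]; exact Set.eq_univ_of_forall fun y => Subsingleton.elim _ _
      rw [this, measure_univ, measure_univ]
  | succ n ih =>
    set e : (Fin (n + 1) → ℝ) → (Fin n → ℝ) × ℝ := fun y => ((fun i : Fin n => y i.succ), y 0)
      with he
    have he_meas : Measurable e := by fun_prop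
    set c : (Fin n → ℝ) × ℝ → (Fin (n + 1) → ℝ) := fun p => Fin.cons p.2 p.1 with hc
    have hc_meas : Measurable c := by
      refine measurable_pi_lambda _ fun i => ?_
      refine Fin.cases ?_ (fun j => ?_) i
      · simpa [hc] using measurable_snd
      · simp only [hc, Fin.cons_succ]
        fun_prop
    have hce : c ∘ e = id := by
      ext y i
      refine Fin.cases ?_ (fun j => ?_) i <;> simp [hc, he]
    set γ : Measure (Fin n → ℝ) := Measure.pi fun _ => gaussianReal 0 1
    set γ' : Measure (Fin (n + 1) → ℝ) := Measure.pi fun _ => gaussianReal 0 1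
    have hγ : γ'.map e = γ.prod (gaussianReal 0 1) := map_pi_gaussianReal_tail n
    have : IsProbabilityMeasure (ν.map e) := Measure.isProbabilityMeasure_map he_meas.aemeasurable
    have hkl : klDiv (ν.map e) (γ.prod (gaussianReal 0 1)) ≤ klDiv ν γ' := by
      rw [← hγ]
      exact klDiv_map_le _ _ he_meas
    have hfst : klDiv (ν.map e).fst γ ≤ klDiv (ν.map e) (γ.prod (gaussianReal 0 1)) := by
      have h := klDiv_map_le (ν.map e) (γ.prod (gaussianReal 0 1)) measurable_fst
      rwa [← Measure.fst, ← Measure.fst, Measure.fst_prod] at h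
    have hkl_ne : klDiv (ν.map e) (γ.prod (gaussianReal 0 1)) ≠ ∞ := ne_top_of_le_ne_top hν hkl
    have hfst_eq : (ν.map e).fst = ν.map (fun y i => y (Fin.succ i)) := by
      rw [Measure.fst, Measure.map_map measurable_fst he_meas]
      rfl
    obtain ⟨S, hS, hSmap, hScost⟩ := ih (ν := (ν.map e).fst)
      (fun i => by
        have htail : Measurable fun (y : Fin (n + 1) → ℝ) (i : Fin n) => y i.succ := by fun_prop
        rw [hfst_eq, memLp_map_measure_iff (measurable_pi_apply i).aestronglyMeasurable
          htail.aemeasurable]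
        exact hν2 i.succ) (ne_top_of_le_ne_top hkl_ne hfst)
    obtain ⟨T, hT, hTmap, hTcost⟩ := exists_map_prod_gaussianReal (ρ := ν.map e)
      (by
        rw [memLp_map_measure_iff (by fun_prop) (by fun_prop)]
        exact hν2 0) hkl_ne hS hSmap
    refine ⟨fun y => c (S (e y).1, T (e y)), by fun_prop, ?_, ?_⟩
    · have h : (fun y => c (S (e y).1, T (e y))) = c ∘ (fun p => (S p.1, T p)) ∘ e := rfl
      rw [h, ← Measure.map_map hc_meas (by fun_prop), ← Measure.map_map (by fun_prop) he_meas,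
        hTmap, ← hγ, Measure.map_map hc_meas he_meas, hce, Measure.map_id]
    · rw [lintegral_map (by fun_prop) he_meas] at hTcost
      refine le_trans ?_ (hTcost.trans (by gcongr))
      rw [Fin.sum_univ_succ, add_comm]
      refine add_le_add (le_trans (le_of_eq ?_) hScost) le_rfl
      refine Finset.sum_congr rfl fun i _ => ?_
      rw [hfst_eq, lintegral_map (by fun_prop) (by fun_prop)]
      rfl

lemma pi_gaussianReal_eq_withDensity (n : ℕ) :
    (Measure.pi fun _ : Fin n => gaussianReal 0 1) =
      volume.withDensity fun x => ENNReal.ofReal (∏ i, gaussianPDFReal 0 1 (x i)) := by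
  refine (Measure.pi_eq fun s hs => ?_)
  have hint : ∀ i, Integrable (gaussianPDFReal 0 1) (volume.restrict (s i)) :=
    fun i => (integrable_gaussianPDFReal 0 1).restrict
  rw [withDensity_apply _ (MeasurableSet.univ_pi hs), volume_pi, Measure.restrict_pi_pi,
    ← ofReal_integral_eq_lintegral_ofReal (Integrable.fintype_prod hint)
      (ae_of_all _ fun x => Finset.prod_nonneg fun i _ => gaussianPDFReal_nonneg _ _ _),
    integral_fintype_prod_eq_prod (fun _ => gaussianPDFReal 0 1),
    ENNReal.ofReal_prod_of_nonneg
      fun i _ => integral_nonneg fun x => gaussianPDFReal_nonneg _ _ _]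
  simp_rw [gaussianReal_apply_eq_integral 0 one_ne_zero]

lemma prod_gaussianPDFReal {n : ℕ} (x : EuclideanSpace ℝ (Fin n)) :
    ∏ i, gaussianPDFReal 0 1 (x i) =
      (2 * Real.pi) ^ (-(n : ℝ) / 2) * Real.exp (-‖x‖ ^ 2 / 2) := by
  simp only [gaussianPDFReal, NNReal.coe_one, mul_one, sub_zero, Finset.prod_mul_distrib,
    Finset.prod_const, Finset.card_univ, Fintype.card_fin, ← Real.exp_sum,
    EuclideanSpace.real_norm_sq_eq]
  congr 1
  · rw [Real.sqrt_eq_rpow, ← Real.rpow_neg (by positivity), ← Real.rpow_natCast,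
      ← Real.rpow_mul (by positivity)]
    ring_nf
  · rw [← Finset.sum_div, Finset.sum_neg_distrib]

lemma map_toLp_pi_gaussianReal (n : ℕ) :
    (Measure.pi fun _ : Fin n => gaussianReal 0 1).map (WithLp.toLp 2) =
      _root_.stdGaussian n := by
  ext s hs
  rw [Measure.map_apply (by fun_prop) hs, pi_gaussianReal_eq_withDensity,
    withDensity_apply _ (hs.preimage (by fun_prop)), _root_.stdGaussian, withDensity_apply _ hs,
    ← (PiLp.volume_preserving_toLp (Fin n)).setLIntegral_comp_preimage hs (by fun_prop)]
  simp_rw [← prod_gaussianPDFReal]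

instance isProbabilityMeasure_stdGaussian (n : ℕ) :
    IsProbabilityMeasure (_root_.stdGaussian n) := by
  rw [← map_toLp_pi_gaussianReal]
  exact Measure.isProbabilityMeasure_map (by fun_prop)

lemma klDiv_le_relEntropy {E : Type*} [MeasurableSpace E] (μ γ : Measure E)
    [IsProbabilityMeasure μ] [IsProbabilityMeasure γ] : klDiv μ γ ≤ relEntropy μ γ := by
  rw [relEntropy]
  split_ifs with h
  · simp [klDiv_of_ac_of_integrable h.1 h.2]
  · exact le_top

lemma sq_nnnorm_euclideanSpace {n : ℕ} (x : EuclideanSpace ℝ (Fin n)) :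
    (‖x‖₊ : ℝ≥0∞) ^ 2 = ∑ i, ENNReal.ofReal (x i ^ 2) := by
  rw [← ENNReal.ofReal_sum_of_nonneg fun i _ => sq_nonneg _,
    ← EuclideanSpace.real_norm_sq_eq, ENNReal.ofReal_pow (norm_nonneg _), ofReal_norm,
    enorm_eq_nnnorm]

/-- A map on Euclidean space transporting `ν` to the standard Gaussian measure, with quadratic cost
at most twice the divergence. -/
theorem exists_map_stdGaussian {n : ℕ} {ν : Measure (EuclideanSpace ℝ (Fin n))}
    [IsProbabilityMeasure ν] (hν2 : ∫⁻ x, ‖x‖₊ ^ 2 ∂ν < ∞)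
    (hν : klDiv ν (_root_.stdGaussian n) ≠ ∞) :
    ∃ S : EuclideanSpace ℝ (Fin n) → EuclideanSpace ℝ (Fin n), Measurable S ∧
      ν.map S = _root_.stdGaussian n ∧
      ∫⁻ y, ‖S y - y‖₊ ^ 2 ∂ν ≤ 2 * klDiv ν (_root_.stdGaussian n) := by
  set f : EuclideanSpace ℝ (Fin n) → (Fin n → ℝ) := WithLp.ofLp
  have hf : Measurable f := by fun_prop
  have hγ : (_root_.stdGaussian n).map f = Measure.pi fun _ => gaussianReal 0 1 := by
    rw [← map_toLp_pi_gaussianReal, Measure.map_map hf (by fun_prop)]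
    exact Measure.map_id
  have hkl := klDiv_map_le ν (_root_.stdGaussian n) hf
  rw [hγ] at hkl
  have : IsProbabilityMeasure (ν.map f) := Measure.isProbabilityMeasure_map hf.aemeasurable
  obtain ⟨S, hS, hSmap, hScost⟩ := exists_map_pi_gaussianReal (ν := ν.map f)
    (fun i => by
      rw [memLp_map_measure_iff (measurable_pi_apply i).aestronglyMeasurable hf.aemeasurable,
        memLp_two_iff_integrable_sq (by fun_prop)]
      refine ⟨by fun_prop, lt_of_le_of_lt (lintegral_mono fun y => ?_) hν2⟩
      rw [sq_nnnorm_euclideanSpace, Real.enorm_eq_ofReal (sq_nonneg _)]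
      exact Finset.single_le_sum (f := fun i => ENNReal.ofReal (y i ^ 2))
        (fun _ _ => zero_le) (Finset.mem_univ i)) (ne_top_of_le_ne_top hν hkl)
  refine ⟨fun y => WithLp.toLp 2 (S (f y)), by fun_prop, ?_, ?_⟩
  · rw [← map_toLp_pi_gaussianReal, ← hSmap, Measure.map_map hS hf,
      Measure.map_map (by fun_prop) (hS.comp hf)]
    rfl
  · refine le_trans (le_of_eq ?_) (hScost.trans (by gcongr))
    simp_rw [sq_nnnorm_euclideanSpace]
    rw [lintegral_finsetSum _ fun i _ => by fun_prop]
    refine Finset.sum_congr rfl fun i _ => ?_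
    rw [lintegral_map (by fun_prop) hf]
    rfl

end

/-- Talagrand's quadratic transport-entropy inequality: `W₂(γ,ν)² ≤ 2 D(ν‖γ)`. -/
theorem talagrand_transport_entropy {n : ℕ} (hn : 1 ≤ n)
    (ν : Measure (EuclideanSpace ℝ (Fin n))) [IsProbabilityMeasure ν]
    (hν2 : ∫⁻ x, ‖x‖₊ ^ 2 ∂ν < ∞) :
    ⨅ π : {π : Measure (EuclideanSpace ℝ (Fin n) × EuclideanSpace ℝ (Fin n)) //
        IsProbabilityMeasure π ∧ IsCoupling π (stdGaussian n) ν},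
        ∫⁻ p, ‖p.1 - p.2‖₊ ^ 2
          ∂(π : Measure (EuclideanSpace ℝ (Fin n) × EuclideanSpace ℝ (Fin n))) ≤
      2 * relEntropy ν (stdGaussian n) := by
  have hkl := klDiv_le_relEntropy ν (stdGaussian n)
  by_cases h : relEntropy ν (stdGaussian n) = ∞
  · simp [h]
  obtain ⟨S, hS, hSmap, hScost⟩ := exists_map_stdGaussian hν2 (ne_top_of_le_ne_top h hkl)
  have hSy : Measurable fun y => (S y, y) := by fun_prop
  refine iInf_le_of_le ⟨ν.map fun y => (S y, y),
    Measure.isProbabilityMeasure_map hSy.aemeasurable, ?_, ?_⟩ ?_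
  · rw [Measure.map_map measurable_fst hSy]
    exact hSmap
  · rw [Measure.map_map measurable_snd hSy]
    exact Measure.map_id
  · rw [lintegral_map (by fun_prop) hSy]
    exact hScost.trans (by gcongr)
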